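/- Let Ω ⊆ D = (0,1)^d be a set of finite perimeter and p ≥ 1. Define φ̄_ε(x) := ∫_D ε^{-(d+1)} 1_{‖x−y‖≤ε} |1_Ω(x) − 1_Ω(y)| dy. Then ∫_D φ̄_ε(x)^p dx ≤ (α_d^{p−1} σ_d / ε^{p−1}) Per(Ω), where α_d is the volume of the d-dimensional unit ball, σ_d the surface tension, and Per(Ω) the relative perimeter of Ω in D. -/

import Mathlib

open MeasureTheory Filter Metric Finset ProbabilityTheory
open scoped ENNReal NNReal Topology Classical BigOperators RealInnerProductSpace

noncomputable section

/-- Euclidean space `ℝ^d`. -/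
abbrev Euc (d : ℕ) := EuclideanSpace ℝ (Fin d)

/-- The open unit cube `D = (0,1)^d`. -/
def unitCube (d : ℕ) : Set (Euc d) := {x | ∀ i, x i ∈ Set.Ioo (0:ℝ) 1}

/-- The surface tension `σ_d = ∫_{‖z‖ ≤ 1} |z_1| dz`. -/
def sigmad (d : ℕ) [NeZero d] : ℝ := ∫ z in closedBall (0 : Euc d) 1, |z 0|

/-- `α_d`, the volume of the unit ball in `ℝ^d`. -/
def alphad (d : ℕ) : ℝ := (volume (closedBall (0 : Euc d) 1)).toReal

/-- Divergence of a vector field. -/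
def divg {d : ℕ} (v : Euc d → Euc d) (x : Euc d) : ℝ :=
  ∑ i, fderiv ℝ v x (EuclideanSpace.single i 1) i

/-- The set of values `∫_Ω div v` over admissible test vector fields on `D`. -/
def perimSet (d : ℕ) (Ω : Set (Euc d)) : Set ℝ :=
  {P | ∃ v : Euc d → Euc d, ContDiff ℝ (⊤ : ℕ∞) v ∧ HasCompactSupport v ∧
        tsupport v ⊆ unitCube d ∧ (∀ x ∈ unitCube d, ‖v x‖ ≤ 1) ∧
        P = ∫ x in Ω, divg v x}

/-- Relative perimeter of `Ω` in `D = (0,1)^d` (BV sense). -/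
def relPerim (d : ℕ) (Ω : Set (Euc d)) : ℝ := sSup (perimSet d Ω)

/-- `Ω` has finite relative perimeter in `D`. -/
def HasFinitePerimeter (d : ℕ) (Ω : Set (Euc d)) : Prop := BddAbove (perimSet d Ω)

/-- Nonlocal perimeter `Per_ε(Ω) = (2/ε^{d+1}) ∫_Ω ∫_{D\Ω} 1_{‖x−y‖≤ε}`. -/
def nlPerim (d : ℕ) (ε : ℝ) (Ω : Set (Euc d)) : ℝ :=
  (2 / ε ^ (d + 1)) * ∫ x in Ω, ∫ y in unitCube d \ Ω, (if dist x y ≤ ε then (1:ℝ) else 0)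

/-- The kernel `φ_ε(x,y) = ε^{-(d+1)} 1_{‖x−y‖≤ε} |1_Ω(x) − 1_Ω(y)|`. -/
def phie (d : ℕ) (ε : ℝ) (Ω : Set (Euc d)) (x y : Euc d) : ℝ :=
  (if dist x y ≤ ε then (1:ℝ) else 0) / ε ^ (d + 1) *
    |Set.indicator Ω (fun _ => (1:ℝ)) x - Set.indicator Ω (fun _ => (1:ℝ)) y|

/-- `φ̄_ε(x) = ∫_D φ_ε(x,y) dy`. -/
def phibar (d : ℕ) (ε : ℝ) (Ω : Set (Euc d)) (x : Euc d) : ℝ :=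
  ∫ y in unitCube d, phie d ε Ω x y

/-- The graph perimeter `GPer_{n,ε}(Ω) = (2/(n(n−1))) Σ_{i<j} φ_ε(x_i,x_j)`. -/
def GPer (d n : ℕ) (ε : ℝ) (Ω : Set (Euc d)) (xs : Fin n → Euc d) : ℝ :=
  (2 / ((n:ℝ) * ((n:ℝ) - 1))) *
    ∑ i : Fin n, ∑ j : Fin n, if i < j then phie d ε Ω (xs i) (xs j) else 0

/-- `Ω` has a smooth boundary: it is the sublevel set of a smooth function
with nonvanishing gradient on the boundary. -/
def HasSmoothBoundary {d : ℕ} (Ω : Set (Euc d)) : Prop :=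
  ∃ f : Euc d → ℝ, ContDiff ℝ (⊤ : ℕ∞) f ∧ Ω = {x | f x < 0} ∧
    ∀ x ∈ frontier Ω, fderiv ℝ f x ≠ 0

/-- Volume of the spherical cap `B_d(0,1) ∩ {x : x_d ≥ t}`. -/
def capVol (d : ℕ) [NeZero d] (t : ℝ) : ℝ :=
  (volume (closedBall (0 : Euc d) 1 ∩
    {x : Euc d | t ≤ x ⟨d - 1, Nat.sub_lt (Nat.pos_of_neZero d) one_pos⟩})).toReal

/-- The constant `C_d = 2 ∫_0^1 |B_d(0,1) ∩ {x_d ≥ t}|² dt`. -/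
def Cd (d : ℕ) [NeZero d] : ℝ := 2 * ∫ t in Set.Ioo (0:ℝ) 1, (capVol d t) ^ 2

/-- Perimeter as Hausdorff measure of the boundary, `H^{d−1}(∂Ω)`. -/
def perimH (d : ℕ) (Ω : Set (Euc d)) : ℝ := (μH[(d:ℝ) - 1] (frontier Ω)).toReal

/-- The rate `f(n,ε)` from the moment estimates. -/
def frate (d n : ℕ) (ε : ℝ) : ℝ :=
  if (n:ℝ) ^ (-(1:ℝ)/(d:ℝ)) ≤ ε then 1 / Real.sqrt ((n:ℝ) * ε)
  else 1 / ((n:ℝ) * ε ^ (((d:ℝ) + 1)/2))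

lemma exists_linearIsometryEquiv_apply_eq {E : Type*} [NormedAddCommGroup E]
    [InnerProductSpace ℝ E] {v w : E} (h : ‖v‖ = ‖w‖) : ∃ R : E ≃ₗᵢ[ℝ] E, R v = w :=
  ⟨_, Submodule.reflection_sub h⟩

/-- The first absolute moment of a linear functional over a ball, by rotation invariance. -/
lemma lintegral_closedBall_enorm_clm {d : ℕ} [NeZero d] {ε : ℝ} (hε : 0 < ε)
    (L : Euc d →L[ℝ] ℝ) :
    ∫⁻ z in closedBall (0 : Euc d) ε, ‖L z‖ₑ
      = ENNReal.ofReal (ε ^ (d + 1) * sigmad d) * ‖L‖ₑ := by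
  obtain ⟨a, rfl⟩ := (InnerProductSpace.toDual ℝ (Euc d)).surjective L
  have he : ‖(EuclideanSpace.single 0 1 : Euc d)‖ = 1 := by simp
  obtain ⟨R, hR⟩ : ∃ R : Euc d ≃ₗᵢ[ℝ] Euc d,
      R (‖a‖ • EuclideanSpace.single 0 1) = a :=
    exists_linearIsometryEquiv_apply_eq (by rw [norm_smul, he]; simp)
  have hRz (z : Euc d) : inner ℝ a (R z) = ‖a‖ * z 0 := by
    conv_lhs => rw [← hR]
    rw [R.inner_map_map, real_inner_smul_left, EuclideanSpace.inner_single_left]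
    simp
  have hint : ∫ z in closedBall (0 : Euc d) ε, ‖inner ℝ a z‖
      = ε ^ (d + 1) * sigmad d * ‖a‖ := by
    have h1 : ∫ z in closedBall (0 : Euc d) ε, ‖inner ℝ a z‖
        = ∫ z in closedBall (0 : Euc d) ε, ‖a‖ * |z 0| := by
      have := R.measurePreserving.setIntegral_preimage_emb
        R.toHomeomorph.measurableEmbedding (fun z => ‖inner ℝ a z‖) (closedBall (0 : Euc d) ε)
      rw [← this]
      have hpre : R ⁻¹' closedBall (0 : Euc d) ε = closedBall 0 ε := by
        ext z; simp
      rw [hpre]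
      refine integral_congr_ae (Eventually.of_forall fun z => ?_)
      simp only [hRz, Real.norm_eq_abs, abs_mul, abs_norm]
    have h2 := Measure.setIntegral_comp_smul_of_pos (volume : Measure (Euc d))
      (fun z : Euc d => |z 0|) (closedBall (0 : Euc d) 1) hε
    rw [_root_.smul_closedBall _ _ zero_le_one, smul_zero, Real.norm_of_nonneg hε.le, mul_one] at h2
    have h3 : ∫ z in closedBall (0 : Euc d) 1, |(ε • z) 0| = ε * sigmad d := by
      simp only [sigmad, PiLp.smul_apply, smul_eq_mul, abs_mul, abs_of_pos hε]
      rw [integral_const_mul]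
    rw [h3, finrank_euclideanSpace_fin, smul_eq_mul] at h2
    rw [h1, integral_const_mul]
    have hpos : (0 : ℝ) < ε ^ d := pow_pos hε d
    rw [eq_inv_mul_iff_mul_eq₀ hpos.ne'] at h2
    rw [← h2]; ring
  have hI : IntegrableOn (fun z : Euc d => inner ℝ a z) (closedBall (0 : Euc d) ε) :=
    (by fun_prop : Continuous fun z : Euc d => inner ℝ a z).continuousOn.integrableOn_compact
      (isCompact_closedBall _ _)
  simp only [InnerProductSpace.toDual_apply_apply]
  rw [← ofReal_integral_norm_eq_lintegral_enorm hI, hint,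
    ENNReal.ofReal_mul' (norm_nonneg a), ofReal_norm]
  simp [enorm_eq_nnnorm]

lemma enorm_sub_le_lintegral_fderiv {E : Type*} [NormedAddCommGroup E] [NormedSpace ℝ E]
    {g : E → ℝ} (hg : ContDiff ℝ 1 g) (x z : E) :
    ‖g (x + z) - g x‖ₑ ≤ ∫⁻ t in Set.Icc (0 : ℝ) 1, ‖fderiv ℝ g (x + t • z) z‖ₑ := by
  have hd (t : ℝ) :
      HasDerivAt (fun s : ℝ => g (x + s • z)) (fderiv ℝ g (x + t • z) z) t := by
    have h1 : HasDerivAt (fun s : ℝ => x + s • z) z t := by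
      simpa using ((hasDerivAt_id t).smul_const z).const_add x
    exact ((hg.differentiable one_ne_zero).differentiableAt.hasFDerivAt).comp_hasDerivAt t h1
  have hc : Continuous fun t : ℝ => fderiv ℝ g (x + t • z) z :=
    ((hg.continuous_fderiv one_ne_zero).comp (by fun_prop)).clm_apply continuous_const
  have := intervalIntegral.integral_eq_sub_of_hasDerivAt (a := 0) (b := 1)
    (fun t _ => hd t) (hc.intervalIntegrable _ _)
  simp only [one_smul, zero_smul, add_zero] at this
  rw [← this, intervalIntegral.integral_of_le zero_le_one, ← integral_Icc_eq_integral_Ioc]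
  exact enorm_integral_le_lintegral_enorm _

/-- The nonlocal variation of a `C¹` function on a convex set is controlled by its gradient. -/
lemma lintegral_nonlocal_variation_le {d : ℕ} [NeZero d] {ε : ℝ} (hε : 0 < ε)
    {g : Euc d → ℝ} (hg : ContDiff ℝ 1 g) {K : Set (Euc d)} (hK : Convex ℝ K)
    (hKm : MeasurableSet K) :
    ∫⁻ x in K, ∫⁻ y in K, (if dist x y ≤ ε then ‖g x - g y‖ₑ else 0)
      ≤ ENNReal.ofReal (ε ^ (d + 1) * sigmad d) * ∫⁻ x in K, ‖fderiv ℝ g x‖ₑ := by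
  set G : Euc d → Euc d → ℝ≥0∞ := fun w z =>
    K.indicator 1 w * (closedBall (0 : Euc d) ε).indicator (fun z => ‖fderiv ℝ g w z‖ₑ) z
    with hG
  have hGm : Measurable (Function.uncurry G) := by
    have h1 : Measurable fun q : Euc d × Euc d => ‖fderiv ℝ g q.1 q.2‖ₑ :=
      (((hg.continuous_fderiv one_ne_zero).comp continuous_fst).clm_apply
        continuous_snd).measurable.enorm
    have h2 : Measurable fun q : Euc d × Euc d => K.indicator (1 : Euc d → ℝ≥0∞) q.1 :=
      (measurable_one.indicator hKm).comp measurable_fst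
    have h3 := h1.indicator
      ((measurableSet_closedBall (x := (0 : Euc d)) (ε := ε)).preimage measurable_snd)
    exact h2.mul h3
  have hstep (x z : Euc d) : K.indicator 1 x * (K.indicator 1 (x + z) *
      (if dist x (x + z) ≤ ε then ‖g x - g (x + z)‖ₑ else 0))
      ≤ ∫⁻ t in Set.Icc (0 : ℝ) 1, G (x + t • z) z := by
    by_cases hx : x ∈ K
    swap
    · simp [hx]
    by_cases hxz : x + z ∈ K
    swap
    · simp [hxz]
    by_cases hz : ‖z‖ ≤ ε
    swap
    · simp [hz]
    simp only [hx, hxz, Set.indicator_of_mem, Pi.one_apply, one_mul, dist_self_add_right, hz,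
      if_true]
    rw [← enorm_neg, neg_sub]
    refine (enorm_sub_le_lintegral_fderiv hg x z).trans (setLIntegral_mono' measurableSet_Icc ?_)
    intro t ht
    have hm : x + t • z ∈ K := by
      have := hK.add_smul_sub_mem hx hxz ht
      simpa using this
    simp [hG, hm, hz]
  calc ∫⁻ x in K, ∫⁻ y in K, (if dist x y ≤ ε then ‖g x - g y‖ₑ else 0)
      = ∫⁻ x, ∫⁻ z, K.indicator 1 x * (K.indicator 1 (x + z) *
          (if dist x (x + z) ≤ ε then ‖g x - g (x + z)‖ₑ else 0)) := by
        rw [← lintegral_indicator hKm]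
        refine lintegral_congr fun x => ?_
        rw [lintegral_add_left_eq_self (fun y => K.indicator 1 x * (K.indicator 1 y *
          (if dist x y ≤ ε then ‖g x - g y‖ₑ else 0))) x]
        by_cases hx : x ∈ K
        · simp only [hx, Set.indicator_of_mem, Pi.one_apply, one_mul]
          rw [← lintegral_indicator hKm]
          refine lintegral_congr fun y => ?_
          by_cases hy : y ∈ K <;> simp [hy]
        · simp [hx]
    _ ≤ ∫⁻ x, ∫⁻ z, ∫⁻ t in Set.Icc (0 : ℝ) 1, G (x + t • z) z :=
        lintegral_mono fun x => lintegral_mono fun z => hstep x z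
    _ = ∫⁻ z, ∫⁻ x, ∫⁻ t in Set.Icc (0 : ℝ) 1, G (x + t • z) z := by
        refine lintegral_lintegral_swap (Measurable.aemeasurable ?_)
        refine Measurable.lintegral_prod_right' (f := fun (q : (Euc d × Euc d) × ℝ) =>
          G (q.1.1 + q.2 • q.1.2) q.1.2) ?_
        exact hGm.comp (by fun_prop :
          Measurable fun q : (Euc d × Euc d) × ℝ => (q.1.1 + q.2 • q.1.2, q.1.2))
    _ = ∫⁻ z, ∫⁻ x, G x z := by
        refine lintegral_congr fun z => ?_
        rw [lintegral_lintegral_swap (Measurable.aemeasurable ?_)]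
        · have (t : ℝ) : ∫⁻ x, G (x + t • z) z = ∫⁻ x, G x z :=
            lintegral_add_right_eq_self (fun x => G x z) (t • z)
          simp [this]
        · exact hGm.comp (by fun_prop :
            Measurable fun q : Euc d × ℝ => (q.1 + q.2 • z, z))
    _ = ∫⁻ x, ∫⁻ z, G x z := (lintegral_lintegral_swap hGm.aemeasurable).symm
    _ = ∫⁻ x in K, ENNReal.ofReal (ε ^ (d + 1) * sigmad d) * ‖fderiv ℝ g x‖ₑ := by
        rw [← lintegral_indicator hKm]
        refine lintegral_congr fun x => ?_
        by_cases hx : x ∈ K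
        · simp only [hG, hx, Set.indicator_of_mem, Pi.one_apply, one_mul]
          rw [lintegral_indicator measurableSet_closedBall, lintegral_closedBall_enorm_clm hε]
        · simp [hG, hx]
    _ = _ := lintegral_const_mul' _ _ ENNReal.ofReal_ne_top

lemma isOpen_unitCube (d : ℕ) : IsOpen (unitCube d) := by
  have : unitCube d = ⋂ i, {x : Euc d | x i ∈ Set.Ioo (0 : ℝ) 1} := by
    ext x; simp [unitCube]
  rw [this]
  exact isOpen_iInter_of_finite fun i => isOpen_Ioo.preimage (by fun_prop)

lemma volume_unitCube_ne_top (d : ℕ) : volume (unitCube d) ≠ ∞ := by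
  have hb : Bornology.IsBounded (unitCube d) := by
    refine (isBounded_iff_forall_norm_le).2 ⟨√(d : ℝ), fun x hx => ?_⟩
    rw [EuclideanSpace.norm_eq]
    refine Real.sqrt_le_sqrt ?_
    calc ∑ i, ‖x i‖ ^ 2 ≤ ∑ _i : Fin d, (1 : ℝ) := by
          refine Finset.sum_le_sum fun i _ => ?_
          have := hx i
          rw [Real.norm_of_nonneg this.1.le]
          exact pow_le_one₀ this.1.le this.2.le
      _ = d := by simp
  exact hb.measure_lt_top.ne

lemma integrable_indicator_one {d : ℕ} {Ω : Set (Euc d)} (hΩ : MeasurableSet Ω)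
    (hsub : Ω ⊆ unitCube d) : Integrable (Ω.indicator fun _ => (1 : ℝ)) := by
  refine (integrable_indicator_iff hΩ).2 (integrableOn_const ?_)
  exact ((measure_mono hsub).trans_lt (volume_unitCube_ne_top d).lt_top).ne

lemma relPerim_nonneg {d : ℕ} {Ω : Set (Euc d)} (hfin : HasFinitePerimeter d Ω) :
    0 ≤ relPerim d Ω := by
  refine le_csSup hfin ⟨0, contDiff_const, HasCompactSupport.zero, ?_, ?_, ?_⟩
  · simp [tsupport]
  · simp
  · simp [divg]

/-- The mollification of a function by a normalized bump. -/
def mollify {d : ℕ} {F : Type*} [NormedAddCommGroup F] [NormedSpace ℝ F]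
    (φ : ContDiffBump (0 : Euc d)) (f : Euc d → F) : Euc d → F :=
  convolution (φ.normed volume) f (ContinuousLinearMap.lsmul ℝ ℝ) volume

section Mollify

variable {d : ℕ} {F : Type*} [NormedAddCommGroup F] [NormedSpace ℝ F]
  (φ : ContDiffBump (0 : Euc d))

lemma mollify_apply (f : Euc d → F) (x : Euc d) :
    mollify φ f x = ∫ t, φ.normed volume t • f (x - t) := rfl

lemma contDiff_mollify {f : Euc d → F} (hf : LocallyIntegrable f) :
    ContDiff ℝ (⊤ : ℕ∞) (mollify φ f) :=
  φ.hasCompactSupport_normed.contDiff_convolution_left _ φ.contDiff_normed hf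

lemma norm_mollify_le_one {f : Euc d → F} (hf : ∀ x, ‖f x‖ ≤ 1) (x : Euc d) :
    ‖mollify φ f x‖ ≤ 1 := by
  rw [mollify_apply, ← φ.integral_normed (μ := (volume : Measure (Euc d)))]
  refine norm_integral_le_of_norm_le φ.integrable_normed (Eventually.of_forall fun t => ?_)
  rw [norm_smul, Real.norm_of_nonneg (φ.nonneg_normed t)]
  exact mul_le_of_le_one_right (φ.nonneg_normed t) (hf _)

lemma tsupport_mollify_subset (f : Euc d → F) :
    tsupport (mollify φ f) ⊆ cthickening φ.rOut (tsupport f) := by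
  refine closure_minimal ?_ isClosed_cthickening
  refine (support_convolution_subset _).trans ?_
  rw [φ.support_normed_eq]
  rintro _ ⟨a, ha, b, hb, rfl⟩
  refine mem_cthickening_of_dist_le _ b _ _ (subset_tsupport f hb) ?_
  simpa using (mem_ball_zero_iff.1 ha).le

lemma integrable_normed_smul_comp_sub {h : Euc d → F} (hc : Continuous h) (x : Euc d) :
    Integrable fun t => φ.normed volume t • h (x - t) :=
  Continuous.integrable_of_hasCompactSupport
    ((φ.contDiff_normed (n := 0)).continuous.smul (hc.comp (by fun_prop)))
    φ.hasCompactSupport_normed.smul_right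

lemma fderiv_mollify_apply [CompleteSpace F] {v : Euc d → F} (hv : ContDiff ℝ 1 v)
    (hvc : HasCompactSupport v) (x e : Euc d) :
    fderiv ℝ (mollify φ v) x e = mollify φ (fun y => fderiv ℝ v y e) x := by
  have h := hvc.hasFDerivAt_convolution_right (μ := volume) (ContinuousLinearMap.lsmul ℝ ℝ)
    (φ.integrable_normed (μ := volume)).locallyIntegrable hv x
  rw [mollify, h.fderiv, mollify_apply, convolution_def, ContinuousLinearMap.integral_apply]
  · rfl
  · exact integrable_normed_smul_comp_sub φ (hv.continuous_fderiv one_ne_zero) x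

lemma continuous_divg {v : Euc d → Euc d} (hv : ContDiff ℝ 1 v) : Continuous (divg v) := by
  have := hv.continuous_fderiv one_ne_zero
  unfold divg
  fun_prop

lemma hasCompactSupport_divg {v : Euc d → Euc d} (hvc : HasCompactSupport v) :
    HasCompactSupport (divg v) := by
  refine (hvc.fderiv ℝ).mono fun x hx => ?_
  contrapose! hx
  simp only [Function.mem_support, not_not] at hx ⊢
  simp [divg, hx]

lemma divg_mollify {v : Euc d → Euc d} (hv : ContDiff ℝ 1 v)
    (hvc : HasCompactSupport v) (x : Euc d) :
    divg (mollify φ v) x = mollify φ (divg v) x := by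
  have hc (i : Fin d) : Continuous fun y => fderiv ℝ v y (EuclideanSpace.single i 1) :=
    (hv.continuous_fderiv one_ne_zero).clm_apply continuous_const
  have hcoord (i : Fin d) : mollify φ (fun y => fderiv ℝ v y (EuclideanSpace.single i 1)) x i
      = ∫ t, φ.normed volume t * fderiv ℝ v (x - t) (EuclideanSpace.single i 1) i := by
    rw [mollify_apply]
    have := (EuclideanSpace.proj (𝕜 := ℝ) i : Euc d →L[ℝ] ℝ).integral_comp_comm
      (integrable_normed_smul_comp_sub φ (hc i) x)
    exact this.symm
  simp only [divg, fderiv_mollify_apply φ hv hvc, hcoord]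
  rw [← integral_finsetSum]
  · rw [mollify_apply]
    simp [divg, Finset.mul_sum]
  · intro i _
    exact integrable_normed_smul_comp_sub φ (h := fun y =>
      fderiv ℝ v y (EuclideanSpace.single i 1) i) (by have := hc i; fun_prop) x

/-- Mollification by an even bump is self-adjoint. -/
lemma integral_mul_mollify_comm {u h : Euc d → ℝ} (hu : Integrable u)
    (hc : Continuous h) (hh : HasCompactSupport h) :
    ∫ x, u x * mollify φ h x = ∫ x, mollify φ u x * h x := by
  set ρ := φ.normed (volume : Measure (Euc d)) with hρ
  have hρi : Integrable ρ := φ.integrable_normed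
  have hhi : Integrable h := hc.integrable_of_hasCompactSupport hh
  obtain ⟨C, hC⟩ := hh.exists_bound_of_continuous hc
  have hi1 : Integrable (Function.uncurry fun x t => u x * (ρ t * h (x - t)))
      ((volume : Measure (Euc d)).prod (volume : Measure (Euc d))) := by
    have h1 := (hu.mul_prod hρi).mul_bdd (c := C) (g := fun q : Euc d × Euc d => h (q.1 - q.2))
      (hc.comp (by fun_prop)).aestronglyMeasurable (Eventually.of_forall fun q => hC _)
    refine h1.congr (Eventually.of_forall fun q => ?_)
    simp [Function.uncurry, mul_assoc]
  calc ∫ x, u x * mollify φ h x = ∫ x, ∫ t, u x * (ρ t * h (x - t)) := by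
        simp only [mollify_apply, smul_eq_mul, integral_const_mul, hρ]
    _ = ∫ t, ∫ x, u x * (ρ t * h (x - t)) := integral_integral_swap hi1
    _ = ∫ t, ∫ y, u (y + t) * (ρ t * h y) := by
        refine integral_congr_ae (Eventually.of_forall fun t => ?_)
        have := integral_add_right_eq_self (μ := (volume : Measure (Euc d)))
          (fun x => u x * (ρ t * h (x - t))) t
        simpa using this.symm
    _ = ∫ t, ∫ y, u (y - t) * (ρ t * h y) := by
        rw [← integral_neg_eq_self]
        simp only [hρ, φ.normed_neg, sub_eq_add_neg]
    _ = ∫ y, ∫ t, u (y - t) * (ρ t * h y) := by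
        refine (integral_integral_swap ?_).symm
        have h2 := (hρi.convolution_integrand (ContinuousLinearMap.lsmul ℝ ℝ) hu).mul_bdd
          (c := C) (g := fun q : Euc d × Euc d => h q.1)
          (hc.comp continuous_fst).aestronglyMeasurable (Eventually.of_forall fun q => hC _)
        refine h2.congr (Eventually.of_forall fun q => ?_)
        simp only [Function.uncurry, ContinuousLinearMap.lsmul_apply, smul_eq_mul]
        ring
    _ = ∫ x, mollify φ u x * h x := by
        refine integral_congr_ae (Eventually.of_forall fun y => ?_)
        simp only [mollify_apply, smul_eq_mul]
        rw [← integral_mul_const]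
        refine integral_congr_ae (Eventually.of_forall fun t => ?_)
        simp only [hρ]; ring

end Mollify

lemma integral_mul_divg_eq_neg {d : ℕ} {g : Euc d → ℝ} (hg : ContDiff ℝ 1 g)
    {v : Euc d → Euc d} (hv : ContDiff ℝ 1 v) (hvc : HasCompactSupport v) :
    ∫ x, g x * divg v x = -∫ x, fderiv ℝ g x (v x) := by
  have hgc := hg.continuous
  have hg' := hg.continuous_fderiv one_ne_zero
  have hvcont := hv.continuous
  have hv' := hv.continuous_fderiv one_ne_zero
  have hvi (i : Fin d) : ContDiff ℝ 1 fun x => v x i := by fun_prop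
  have hvic (i : Fin d) : HasCompactSupport fun x => v x i :=
    hvc.comp_left (g := fun y : Euc d => y i) rfl
  have hfd (i : Fin d) (x e : Euc d) : fderiv ℝ (fun y => v y i) x e = fderiv ℝ v x e i := by
    have h := ((EuclideanSpace.proj (𝕜 := ℝ) i : Euc d →L[ℝ] ℝ).hasFDerivAt).comp x
      (hv.differentiable one_ne_zero x).hasFDerivAt
    have h' : HasFDerivAt (fun y => v y i) _ x := h
    rw [h'.fderiv]
    rfl
  have hexp (x : Euc d) : fderiv ℝ g x (v x)
      = ∑ i, fderiv ℝ g x (EuclideanSpace.single i 1) * v x i := by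
    conv_lhs => rw [← (EuclideanSpace.basisFun (Fin d) ℝ).sum_repr (v x)]
    simp [mul_comm]
  have hi1 (i : Fin d) : Integrable fun x =>
      fderiv ℝ g x (EuclideanSpace.single i 1) * v x i :=
    Continuous.integrable_of_hasCompactSupport (by fun_prop) (hvic i).mul_left
  have hi2 (i : Fin d) : Integrable fun x =>
      g x * fderiv ℝ (fun y => v y i) x (EuclideanSpace.single i 1) := by
    refine Continuous.integrable_of_hasCompactSupport (by simp only [hfd]; fun_prop)
      (HasCompactSupport.mul_left ?_)
    exact ((hvic i).fderiv ℝ).comp_left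
      (g := fun L : Euc d →L[ℝ] ℝ => L (EuclideanSpace.single i 1)) rfl
  have hi3 (i : Fin d) : Integrable fun x => g x * v x i :=
    Continuous.integrable_of_hasCompactSupport (by fun_prop) (hvic i).mul_left
  calc ∫ x, g x * divg v x
      = ∑ i, ∫ x, g x * fderiv ℝ (fun y => v y i) x (EuclideanSpace.single i 1) := by
        rw [← integral_finsetSum _ fun i _ => hi2 i]
        simp [divg, Finset.mul_sum, hfd]
    _ = ∑ i, -∫ x, fderiv ℝ g x (EuclideanSpace.single i 1) * v x i := by
        refine Finset.sum_congr rfl fun i _ => ?_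
        exact integral_mul_fderiv_eq_neg_fderiv_mul_of_integrable (hi1 i) (hi2 i) (hi3 i)
          (fun x _ => hg.differentiable one_ne_zero x)
          (fun x _ => (hvi i).differentiable one_ne_zero x)
    _ = -∫ x, fderiv ℝ g x (v x) := by
        simp only [hexp]
        rw [Finset.sum_neg_distrib, integral_finsetSum _ fun i _ => hi1 i]

/-- Testing the gradient of a mollified indicator against a field supported well inside the cube
produces at most the relative perimeter. -/
lemma neg_integral_fderiv_mollify_le_relPerim {d : ℕ} {Ω : Set (Euc d)} (hΩ : MeasurableSet Ω)
    (hsub : Ω ⊆ unitCube d) (hfin : HasFinitePerimeter d Ω) (φ : ContDiffBump (0 : Euc d))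
    {v : Euc d → Euc d} (hv : ContDiff ℝ (⊤ : ℕ∞) v) (hvc : HasCompactSupport v)
    (hv1 : ∀ x, ‖v x‖ ≤ 1) (hvs : cthickening φ.rOut (tsupport v) ⊆ unitCube d) :
    -∫ x, fderiv ℝ (mollify φ (Ω.indicator fun _ => (1 : ℝ))) x (v x) ≤ relPerim d Ω := by
  have hu := integrable_indicator_one hΩ hsub
  have hv' : ContDiff ℝ 1 v := hv.of_le (by exact_mod_cast le_top)
  have hg : ContDiff ℝ 1 (mollify φ (Ω.indicator fun _ => (1 : ℝ))) :=
    (contDiff_mollify φ hu.locallyIntegrable).of_le (by exact_mod_cast le_top)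
  rw [← integral_mul_divg_eq_neg hg hv' hvc,
    ← integral_mul_mollify_comm φ hu (continuous_divg hv') (hasCompactSupport_divg hvc)]
  refine le_csSup hfin ⟨mollify φ v, contDiff_mollify φ hv.continuous.locallyIntegrable,
    φ.hasCompactSupport_normed.convolution _ hvc, (tsupport_mollify_subset φ v).trans hvs,
    fun x _ => norm_mollify_le_one φ hv1 x, ?_⟩
  rw [← integral_indicator hΩ]
  refine integral_congr_ae (Eventually.of_forall fun x => ?_)
  by_cases hx : x ∈ Ω <;> simp [hx, divg_mollify φ hv' hvc]

lemma exists_smooth_cutoff {d : ℕ} {K U : Set (Euc d)} (hK : IsCompact K) (hU : IsOpen U)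
    (hKU : K ⊆ U) : ∃ χ : Euc d → ℝ, ContDiff ℝ (⊤ : ℕ∞) χ ∧ HasCompactSupport χ ∧
      tsupport χ ⊆ U ∧ (∀ x, χ x ∈ Set.Icc (0 : ℝ) 1) ∧ ∀ x ∈ K, χ x = 1 := by
  obtain ⟨r, hr, hrU⟩ := hK.exists_cthickening_subset_open hU hKU
  obtain ⟨χ, hχ, hχr, hχs, hχ1⟩ := exists_contMDiff_support_eq_eq_one_iff
    (n := ⊤) (modelWithCornersSelf ℝ (Euc d)) (isOpen_thickening (δ := r) (E := K))
    hK.isClosed (self_subset_thickening hr K)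
  have hts : tsupport χ ⊆ cthickening r K := by
    rw [tsupport, hχs]
    exact closure_thickening_subset_cthickening r K
  exact ⟨χ, contMDiff_iff_contDiff.1 hχ, hK.cthickening.of_isClosed_subset isClosed_closure hts,
    hts.trans hrU, fun x => hχr ⟨x, rfl⟩, fun x hx => (hχ1 x).1 hx⟩

lemma sub_le_sq_mul_inv_sqrt {a δ : ℝ} (ha : 0 ≤ a) (hδ : 0 < δ) :
    a - δ ≤ (√(a ^ 2 + δ ^ 2))⁻¹ * a ^ 2 := by
  have hs : 0 < √(a ^ 2 + δ ^ 2) := Real.sqrt_pos.2 (by positivity)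
  have hle : √(a ^ 2 + δ ^ 2) ≤ a + δ := Real.sqrt_le_iff.2 ⟨by positivity, by nlinarith⟩
  have hge : a ≤ √(a ^ 2 + δ ^ 2) := Real.le_sqrt_of_sq_le (by nlinarith)
  rw [← div_eq_inv_mul, le_div_iff₀ hs]
  nlinarith

lemma lintegral_fderiv_mollify_le_relPerim {d : ℕ} {Ω : Set (Euc d)} (hΩ : MeasurableSet Ω)
    (hsub : Ω ⊆ unitCube d) (hfin : HasFinitePerimeter d Ω) {K : Set (Euc d)}
    (hK : IsCompact K) (hKD : K ⊆ unitCube d) :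
    ∃ r > 0, ∀ φ : ContDiffBump (0 : Euc d), φ.rOut ≤ r →
      ∫⁻ x in K, ‖fderiv ℝ (mollify φ (Ω.indicator fun _ => (1 : ℝ))) x‖ₑ
        ≤ ENNReal.ofReal (relPerim d Ω) := by
  obtain ⟨χ, hχ, hχc, hχs, hχI, hχ1⟩ := exists_smooth_cutoff hK (isOpen_unitCube d) hKD
  obtain ⟨r, hr, hrD⟩ := hχc.isCompact.exists_cthickening_subset_open (isOpen_unitCube d) hχs
  refine ⟨r, hr, fun φ hφ => ?_⟩
  set g := mollify φ (Ω.indicator fun _ => (1 : ℝ)) with hgdef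
  have hg : ContDiff ℝ (⊤ : ℕ∞) g :=
    contDiff_mollify φ (integrable_indicator_one hΩ hsub).locallyIntegrable
  have hg' : ContDiff ℝ (⊤ : ℕ∞) (fderiv ℝ g) := hg.fderiv_right (by simp)
  have hgcont := hg'.continuous
  set G : Euc d → Euc d := fun x => (InnerProductSpace.toDual ℝ (Euc d)).symm (fderiv ℝ g x)
    with hGdef
  have hG : ContDiff ℝ (⊤ : ℕ∞) G :=
    (InnerProductSpace.toDual ℝ (Euc d)).symm.toContinuousLinearEquiv.contDiff.comp hg'
  have hGn (x : Euc d) : ‖G x‖ = ‖fderiv ℝ g x‖ := LinearIsometryEquiv.norm_map _ _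
  have hGi (x : Euc d) : fderiv ℝ g x (G x) = ‖fderiv ℝ g x‖ ^ 2 := by
    rw [← hGn, ← real_inner_self_eq_norm_sq, hGdef, InnerProductSpace.toDual_symm_apply]
  have hreg : ∀ δ > 0, ∫ x in K, ‖fderiv ℝ g x‖ ≤ relPerim d Ω + δ * volume.real K := by
    intro δ hδ
    set s : Euc d → ℝ := fun x => (√(‖G x‖ ^ 2 + δ ^ 2))⁻¹ with hs
    have hpos (x : Euc d) : 0 < ‖G x‖ ^ 2 + δ ^ 2 := by positivity
    have hsc : ContDiff ℝ (⊤ : ℕ∞) s :=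
      (((hG.norm_sq ℝ).add contDiff_const).sqrt fun x => (hpos x).ne').inv
        fun x => (Real.sqrt_pos.2 (hpos x)).ne'
    set v : Euc d → Euc d := fun x => -(χ x • s x • G x) with hv
    have hvs : tsupport v ⊆ tsupport χ := closure_mono fun x hx => by
      contrapose! hx
      simp only [Function.mem_support, not_not] at hx ⊢
      simp [hv, hx]
    have hvC : ContDiff ℝ (⊤ : ℕ∞) v := (hχ.smul (hsc.smul hG)).neg
    have hvc : HasCompactSupport v := hχc.isCompact.of_isClosed_subset isClosed_closure hvs
    have hv1 (x : Euc d) : ‖v x‖ ≤ 1 := by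
      have h1 : ‖s x • G x‖ ≤ 1 := by
        rw [norm_smul, Real.norm_of_nonneg (by positivity), hs, ← div_eq_inv_mul]
        exact div_le_one_of_le₀ (Real.le_sqrt_of_sq_le (by nlinarith)) (Real.sqrt_nonneg _)
      rw [hv, norm_neg, norm_smul, Real.norm_of_nonneg (hχI x).1]
      exact mul_le_one₀ (hχI x).2 (norm_nonneg _) h1
    have hle := neg_integral_fderiv_mollify_le_relPerim hΩ hsub hfin φ hvC hvc hv1
      ((cthickening_mono hφ _).trans ((cthickening_subset_of_subset r hvs).trans hrD))
    rw [← hgdef, ← integral_neg] at hle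
    have hval (x : Euc d) : -fderiv ℝ g x (v x) = χ x * (s x * ‖fderiv ℝ g x‖ ^ 2) := by
      simp [hv, hGi]
    simp only [hval] at hle
    have hi : Integrable fun x => χ x * (s x * ‖fderiv ℝ g x‖ ^ 2) := by
      have := hsc.continuous
      have := hχ.continuous
      exact Continuous.integrable_of_hasCompactSupport (by fun_prop) hχc.mul_right
    have hKi : IntegrableOn (fun x => ‖fderiv ℝ g x‖) K :=
      hgcont.norm.continuousOn.integrableOn_compact hK
    have hKc : IntegrableOn (fun _ : Euc d => δ) K := integrableOn_const hK.measure_lt_top.ne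
    have h1 : ∫ x in K, (‖fderiv ℝ g x‖ - δ) ≤ relPerim d Ω := by
      refine le_trans ?_ ((setIntegral_le_integral hi (s := K)
        (Eventually.of_forall fun x => ?_)).trans hle)
      · refine setIntegral_mono_on (hKi.sub hKc) hi.integrableOn hK.measurableSet fun x hx => ?_
        simp only [hχ1 x hx, one_mul, hs, hGn]
        exact sub_le_sq_mul_inv_sqrt (norm_nonneg _) hδ
      · exact mul_nonneg (hχI x).1 (by positivity)
    rw [integral_sub hKi hKc, setIntegral_const, smul_eq_mul] at h1
    linarith
  have hfinal : ∫ x in K, ‖fderiv ℝ g x‖ ≤ relPerim d Ω := by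
    refine le_of_forall_pos_le_add fun η hη => ?_
    have hpos : 0 < volume.real K + 1 := by positivity
    refine (hreg (η / (volume.real K + 1)) (by positivity)).trans ?_
    gcongr
    rw [div_mul_eq_mul_div, div_le_iff₀ hpos]
    nlinarith
  rw [← ofReal_integral_norm_eq_lintegral_enorm
    (hgcont.continuousOn.integrableOn_compact hK)]
  exact ENNReal.ofReal_le_ofReal hfinal

lemma exists_contDiffBump_seq (d : ℕ) : ∃ φ : ℕ → ContDiffBump (0 : Euc d),
    Tendsto (fun n => (φ n).rOut) atTop (𝓝 0) ∧ ∀ n, (φ n).rOut ≤ 2 * (φ n).rIn := by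
  refine ⟨fun n => ⟨1 / (n + 1) / 2, 1 / (n + 1), by positivity, half_lt_self (by positivity)⟩,
    tendsto_one_div_add_atTop_nhds_zero_nat, fun n => ?_⟩
  simp only
  linarith

lemma measurable_nonlocal_kernel {d : ℕ} {f : Euc d → ℝ} (hf : Measurable f) (ε : ℝ) :
    Measurable fun q : Euc d × Euc d =>
      if dist q.1 q.2 ≤ ε then ‖f q.1 - f q.2‖ₑ else 0 := by
  refine Measurable.ite ?_ ?_ measurable_const
  · exact (isClosed_le (by fun_prop) continuous_const).measurableSet
  · exact ((hf.comp measurable_fst).sub (hf.comp measurable_snd)).enorm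

lemma lintegral_nonlocal_variation_indicator_le_of_compact {d : ℕ} [NeZero d] {ε : ℝ}
    (hε : 0 < ε) {Ω : Set (Euc d)} (hΩ : MeasurableSet Ω) (hsub : Ω ⊆ unitCube d)
    (hfin : HasFinitePerimeter d Ω) {K : Set (Euc d)} (hK : IsCompact K) (hKc : Convex ℝ K)
    (hKD : K ⊆ unitCube d) :
    ∫⁻ q in K ×ˢ K, (if dist q.1 q.2 ≤ ε then
        ‖Ω.indicator (fun _ => (1 : ℝ)) q.1 - Ω.indicator (fun _ => (1 : ℝ)) q.2‖ₑ else 0)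
      ≤ ENNReal.ofReal (ε ^ (d + 1) * sigmad d) * ENNReal.ofReal (relPerim d Ω) := by
  set u : Euc d → ℝ := Ω.indicator fun _ => (1 : ℝ) with hu
  have hui : Integrable u := integrable_indicator_one hΩ hsub
  obtain ⟨r, hr, hrφ⟩ := lintegral_fderiv_mollify_le_relPerim hΩ hsub hfin hK hKD
  obtain ⟨φ, hφ, hφ2⟩ := exists_contDiffBump_seq d
  have hsm (n : ℕ) : ContDiff ℝ 1 (mollify (φ n) u) :=
    (contDiff_mollify (φ n) hui.locallyIntegrable).of_le (by exact_mod_cast le_top)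
  have hae : ∀ᵐ x : Euc d, Tendsto (fun n => mollify (φ n) u x) atTop (𝓝 (u x)) :=
    ContDiffBump.ae_convolution_tendsto_right_of_locallyIntegrable hφ
      (Eventually.of_forall hφ2) hui.locallyIntegrable
  have hae2 : ∀ᵐ q : Euc d × Euc d, Tendsto (fun n =>
      if dist q.1 q.2 ≤ ε then ‖mollify (φ n) u q.1 - mollify (φ n) u q.2‖ₑ else 0) atTop
      (𝓝 (if dist q.1 q.2 ≤ ε then ‖u q.1 - u q.2‖ₑ else 0)) := by
    rw [Measure.volume_eq_prod]
    filter_upwards [Measure.quasiMeasurePreserving_fst.ae hae,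
      Measure.quasiMeasurePreserving_snd.ae hae] with q h1 h2
    split_ifs
    · exact (h1.sub h2).enorm
    · exact tendsto_const_nhds
  calc ∫⁻ q in K ×ˢ K, (if dist q.1 q.2 ≤ ε then ‖u q.1 - u q.2‖ₑ else 0)
      = ∫⁻ q in K ×ˢ K, liminf (fun n => if dist q.1 q.2 ≤ ε then
          ‖mollify (φ n) u q.1 - mollify (φ n) u q.2‖ₑ else 0) atTop :=
        lintegral_congr_ae ((ae_restrict_of_ae hae2).mono fun q hq => hq.liminf_eq.symm)
    _ ≤ liminf (fun n => ∫⁻ q in K ×ˢ K, if dist q.1 q.2 ≤ ε then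
          ‖mollify (φ n) u q.1 - mollify (φ n) u q.2‖ₑ else 0) atTop :=
        lintegral_liminf_le fun n => measurable_nonlocal_kernel (hsm n).continuous.measurable ε
    _ ≤ ENNReal.ofReal (ε ^ (d + 1) * sigmad d) * ENNReal.ofReal (relPerim d Ω) := by
        refine liminf_le_of_frequently_le' (Eventually.frequently ?_)
        filter_upwards [hφ.eventually (ge_mem_nhds hr)] with n hn
        rw [Measure.volume_eq_prod, ← Measure.prod_restrict, lintegral_prod _
          (measurable_nonlocal_kernel (hsm n).continuous.measurable ε).aemeasurable]
        refine (lintegral_nonlocal_variation_le hε (hsm n) hKc hK.measurableSet).trans ?_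
        gcongr
        exact hrφ (φ n) hn

/-- The closed cube `[δ, 1 - δ]^d`. -/
def closedSubcube (d : ℕ) (δ : ℝ) : Set (Euc d) := {x | ∀ i, x i ∈ Set.Icc δ (1 - δ)}

lemma convex_closedSubcube (d : ℕ) (δ : ℝ) : Convex ℝ (closedSubcube d δ) := by
  intro x hx y hy a b ha hb hab i
  exact convex_Icc δ (1 - δ) (hx i) (hy i) ha hb hab

lemma closedSubcube_subset_unitCube (d : ℕ) {δ : ℝ} (hδ : 0 < δ) :
    closedSubcube d δ ⊆ unitCube d :=
  fun _ hx i => ⟨hδ.trans_le (hx i).1, (hx i).2.trans_lt (by linarith)⟩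

lemma isCompact_closedSubcube (d : ℕ) (δ : ℝ) : IsCompact (closedSubcube d δ) := by
  have h : IsCompact (Set.univ.pi fun _ : Fin d => Set.Icc δ (1 - δ)) :=
    isCompact_univ_pi fun _ => isCompact_Icc
  have := (EuclideanSpace.equiv (Fin d) ℝ).toHomeomorph.isCompact_preimage.2 h
  convert this using 1
  ext x
  exact ⟨fun hx i _ => hx i, fun hx i => hx i trivial⟩

lemma iUnion_closedSubcube (d : ℕ) :
    ⋃ n : ℕ, closedSubcube d (1 / ((n : ℝ) + 1)) ×ˢ closedSubcube d (1 / ((n : ℝ) + 1))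
      = unitCube d ×ˢ unitCube d := by
  refine Set.Subset.antisymm (Set.iUnion_subset fun n => Set.prod_mono
    (closedSubcube_subset_unitCube d (by positivity))
    (closedSubcube_subset_unitCube d (by positivity))) ?_
  rintro ⟨x, y⟩ ⟨hx, hy⟩
  have hev {z : Euc d} (hz : z ∈ unitCube d) :
      ∀ᶠ n : ℕ in atTop, z ∈ closedSubcube d (1 / ((n : ℝ) + 1)) := by
    refine eventually_all.2 fun i => ?_
    have h0 := tendsto_one_div_add_atTop_nhds_zero_nat (𝕜 := ℝ)
    filter_upwards [h0.eventually (ge_mem_nhds (hz i).1),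
      h0.eventually (ge_mem_nhds (sub_pos.2 (hz i).2))] with n h1 h2
    exact ⟨h1, by linarith⟩
  obtain ⟨n, h1, h2⟩ := ((hev hx).and (hev hy)).exists
  exact Set.mem_iUnion.2 ⟨n, h1, h2⟩

lemma lintegral_nonlocal_variation_indicator_le {d : ℕ} [NeZero d] {ε : ℝ} (hε : 0 < ε)
    {Ω : Set (Euc d)} (hΩ : MeasurableSet Ω) (hsub : Ω ⊆ unitCube d)
    (hfin : HasFinitePerimeter d Ω) :
    ∫⁻ q in unitCube d ×ˢ unitCube d, (if dist q.1 q.2 ≤ ε then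
        ‖Ω.indicator (fun _ => (1 : ℝ)) q.1 - Ω.indicator (fun _ => (1 : ℝ)) q.2‖ₑ else 0)
      ≤ ENNReal.ofReal (ε ^ (d + 1) * sigmad d) * ENNReal.ofReal (relPerim d Ω) := by
  rw [← iUnion_closedSubcube, setLIntegral_iUnion_of_directed]
  · exact iSup_le fun n => lintegral_nonlocal_variation_indicator_le_of_compact hε hΩ hsub hfin
      (isCompact_closedSubcube d _) (convex_closedSubcube d _)
      (closedSubcube_subset_unitCube d (by positivity))
  · refine Monotone.directed_le fun m n hmn => ?_
    have h : 1 / ((n : ℝ) + 1) ≤ 1 / ((m : ℝ) + 1) := by gcongr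
    have hs : closedSubcube d (1 / ((m : ℝ) + 1)) ⊆ closedSubcube d (1 / ((n : ℝ) + 1)) :=
      fun x hx i => ⟨h.trans (hx i).1, (hx i).2.trans (by linarith)⟩
    exact Set.prod_mono hs hs

lemma phie_nonneg {d : ℕ} {ε : ℝ} (hε : 0 < ε) (Ω : Set (Euc d)) (x y : Euc d) :
    0 ≤ phie d ε Ω x y := by
  unfold phie
  split_ifs <;> positivity

lemma phie_le {d : ℕ} {ε : ℝ} (hε : 0 < ε) (Ω : Set (Euc d)) (x y : Euc d) :
    phie d ε Ω x y ≤ (closedBall x ε).indicator (fun _ => 1 / ε ^ (d + 1)) y := by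
  have hu : |Ω.indicator (fun _ => (1 : ℝ)) x - Ω.indicator (fun _ => (1 : ℝ)) y| ≤ 1 := by
    by_cases hx : x ∈ Ω <;> by_cases hy : y ∈ Ω <;> simp [hx, hy]
  unfold phie
  by_cases h : dist x y ≤ ε
  · have hy : y ∈ closedBall x ε := by rwa [mem_closedBall']
    rw [if_pos h, Set.indicator_of_mem hy]
    exact mul_le_of_le_one_right (by positivity) hu
  · have hy : y ∉ closedBall x ε := by rwa [mem_closedBall']
    rw [if_neg h, Set.indicator_of_notMem hy]
    simp

lemma measurable_phie {d : ℕ} {Ω : Set (Euc d)} (hΩ : MeasurableSet Ω) (ε : ℝ) :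
    Measurable (Function.uncurry (phie d ε Ω)) := by
  have hu : Measurable (Ω.indicator fun _ => (1 : ℝ)) := measurable_const.indicator hΩ
  have hm : MeasurableSet {q : Euc d × Euc d | dist q.1 q.2 ≤ ε} :=
    (isClosed_le (by fun_prop) continuous_const).measurableSet
  exact ((Measurable.ite hm measurable_const measurable_const).div_const _).mul
    (continuous_abs.measurable.comp
      ((hu.comp measurable_fst).sub (hu.comp measurable_snd)))

lemma phibar_nonneg {d : ℕ} {ε : ℝ} (hε : 0 < ε) (Ω : Set (Euc d)) (x : Euc d) :
    0 ≤ phibar d ε Ω x :=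
  integral_nonneg fun y => phie_nonneg hε Ω x y

lemma phibar_le {d : ℕ} {ε : ℝ} (hε : 0 < ε) (Ω : Set (Euc d)) (x : Euc d) :
    phibar d ε Ω x ≤ alphad d / ε := by
  have hI : Integrable ((closedBall x ε).indicator fun _ : Euc d => 1 / ε ^ (d + 1)) :=
    (integrable_indicator_iff measurableSet_closedBall).2
      (integrableOn_const measure_closedBall_lt_top.ne)
  calc phibar d ε Ω x
      ≤ ∫ y in unitCube d, (closedBall x ε).indicator (fun _ => 1 / ε ^ (d + 1)) y :=
        integral_mono_of_nonneg (Eventually.of_forall fun y => phie_nonneg hε Ω x y)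
          hI.integrableOn (Eventually.of_forall fun y => phie_le hε Ω x y)
    _ ≤ ∫ y, (closedBall x ε).indicator (fun _ => 1 / ε ^ (d + 1)) y :=
        setIntegral_le_integral hI (Eventually.of_forall fun y =>
          Set.indicator_nonneg (fun _ _ => by positivity) y)
    _ = alphad d / ε := by
        rw [integral_indicator measurableSet_closedBall, setIntegral_const, smul_eq_mul,
          alphad, measureReal_def, Measure.addHaar_closedBall' _ x hε.le,
          finrank_euclideanSpace_fin, ENNReal.toReal_mul,
          ENNReal.toReal_ofReal (by positivity)]
        field_simp
        ring

lemma integrableOn_phibar {d : ℕ} {ε : ℝ} (hε : 0 < ε) {Ω : Set (Euc d)}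
    (hΩ : MeasurableSet Ω) : IntegrableOn (phibar d ε Ω) (unitCube d) := by
  have hm : StronglyMeasurable (phibar d ε Ω) :=
    (measurable_phie hΩ ε).stronglyMeasurable.integral_prod_right
  refine Measure.integrableOn_of_bounded (M := alphad d / ε) (volume_unitCube_ne_top d)
    hm.aestronglyMeasurable (Eventually.of_forall fun x => ?_)
  rw [Real.norm_of_nonneg (phibar_nonneg hε Ω x)]
  exact phibar_le hε Ω x

lemma sigmad_nonneg (d : ℕ) [NeZero d] : 0 ≤ sigmad d :=
  integral_nonneg fun _ => abs_nonneg _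

lemma integral_phibar_le {d : ℕ} [NeZero d] {ε : ℝ} (hε : 0 < ε)
    {Ω : Set (Euc d)} (hΩ : MeasurableSet Ω) (hsub : Ω ⊆ unitCube d)
    (hfin : HasFinitePerimeter d Ω) :
    ∫ x in unitCube d, phibar d ε Ω x ≤ sigmad d * relPerim d Ω := by
  have hk := measurable_nonlocal_kernel
    (measurable_const.indicator hΩ : Measurable (Ω.indicator fun _ => (1 : ℝ))) ε
  have hphi (x y : Euc d) : ENNReal.ofReal (phie d ε Ω x y)
      = ENNReal.ofReal (1 / ε ^ (d + 1)) * (if dist x y ≤ ε then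
        ‖Ω.indicator (fun _ => (1 : ℝ)) x - Ω.indicator (fun _ => (1 : ℝ)) y‖ₑ else 0) := by
    unfold phie
    split_ifs
    · rw [ENNReal.ofReal_mul (by positivity), ← Real.enorm_eq_ofReal_abs]
    · simp
  have hbar (x : Euc d) : ENNReal.ofReal (phibar d ε Ω x)
      = ∫⁻ y in unitCube d, ENNReal.ofReal (phie d ε Ω x y) := by
    have hI : Integrable ((closedBall x ε).indicator fun _ : Euc d => 1 / ε ^ (d + 1)) :=
      (integrable_indicator_iff measurableSet_closedBall).2
        (integrableOn_const measure_closedBall_lt_top.ne)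
    refine ofReal_integral_eq_lintegral_ofReal ?_
      (Eventually.of_forall fun y => phie_nonneg hε Ω x y)
    refine (hI.mono' ((measurable_phie hΩ ε).of_uncurry_left).aestronglyMeasurable
      (Eventually.of_forall fun y => ?_)).integrableOn
    rw [Real.norm_of_nonneg (phie_nonneg hε Ω x y)]
    exact phie_le hε Ω x y
  have hnn : 0 ≤ sigmad d * relPerim d Ω :=
    mul_nonneg (sigmad_nonneg d) (relPerim_nonneg hfin)
  rw [← ENNReal.ofReal_le_ofReal_iff hnn, ofReal_integral_eq_lintegral_ofReal
    (integrableOn_phibar hε hΩ) (Eventually.of_forall fun x => phibar_nonneg hε Ω x)]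
  calc ∫⁻ x in unitCube d, ENNReal.ofReal (phibar d ε Ω x)
      = ENNReal.ofReal (1 / ε ^ (d + 1)) *
        ∫⁻ q in unitCube d ×ˢ unitCube d, (if dist q.1 q.2 ≤ ε then
        ‖Ω.indicator (fun _ => (1 : ℝ)) q.1 - Ω.indicator (fun _ => (1 : ℝ)) q.2‖ₑ else 0) := by
        rw [Measure.volume_eq_prod, ← Measure.prod_restrict, lintegral_prod _ hk.aemeasurable,
          ← lintegral_const_mul' _ _ ENNReal.ofReal_ne_top]
        refine lintegral_congr fun x => ?_
        rw [hbar, ← lintegral_const_mul' _ _ ENNReal.ofReal_ne_top]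
        simp only [hphi]
    _ ≤ ENNReal.ofReal (1 / ε ^ (d + 1)) *
        (ENNReal.ofReal (ε ^ (d + 1) * sigmad d) * ENNReal.ofReal (relPerim d Ω)) := by
        gcongr
        exact lintegral_nonlocal_variation_indicator_le hε hΩ hsub hfin
    _ = ENNReal.ofReal (sigmad d * relPerim d Ω) := by
        have := sigmad_nonneg d
        rw [← ENNReal.ofReal_mul (by positivity), ← ENNReal.ofReal_mul (by positivity)]
        congr 1
        field_simp

/-- `p`-th moment bound for the averaged kernel `φ̄_ε`. -/
theorem phibar_moment_bound (d : ℕ) [NeZero d] (hd : 2 ≤ d)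
    (Ω : Set (Euc d)) (hΩ : MeasurableSet Ω) (hsub : Ω ⊆ unitCube d)
    (hfin : HasFinitePerimeter d Ω) (p : ℝ) (hp : 1 ≤ p) (ε : ℝ) (hε : 0 < ε) :
    ∫ x in unitCube d, phibar d ε Ω x ^ p
      ≤ alphad d ^ (p - 1) * sigmad d / ε ^ (p - 1) * relPerim d Ω := by
  have hα : 0 ≤ alphad d := ENNReal.toReal_nonneg
  have hpt (x : Euc d) :
      phibar d ε Ω x ^ p ≤ (alphad d / ε) ^ (p - 1) * phibar d ε Ω x := by
    have h0 := phibar_nonneg hε Ω x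
    calc phibar d ε Ω x ^ p = phibar d ε Ω x ^ (p - 1) * phibar d ε Ω x := by
          conv_lhs => rw [← sub_add_cancel p 1]
          rw [Real.rpow_add_of_nonneg h0 (by linarith) zero_le_one, Real.rpow_one]
      _ ≤ _ := mul_le_mul_of_nonneg_right
          (Real.rpow_le_rpow h0 (phibar_le hε Ω x) (by linarith)) h0
  calc ∫ x in unitCube d, phibar d ε Ω x ^ p
      ≤ ∫ x in unitCube d, (alphad d / ε) ^ (p - 1) * phibar d ε Ω x :=
        integral_mono_of_nonneg
          (Eventually.of_forall fun x => Real.rpow_nonneg (phibar_nonneg hε Ω x) p)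
          ((integrableOn_phibar hε hΩ).const_mul _) (Eventually.of_forall hpt)
    _ = (alphad d / ε) ^ (p - 1) * ∫ x in unitCube d, phibar d ε Ω x :=
        integral_const_mul _ _
    _ ≤ (alphad d / ε) ^ (p - 1) * (sigmad d * relPerim d Ω) := by
        gcongr
        exact integral_phibar_le hε hΩ hsub hfin
    _ = alphad d ^ (p - 1) * sigmad d / ε ^ (p - 1) * relPerim d Ω := by
        rw [Real.div_rpow hα hε.le]
        ring

end
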